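/- arXiv:1812.03127 — 3 statements merged into one kernel-verified Lean document; each statement's English description precedes it below -/
import Mathlib

section
/- Let G be a locally finite graph (with unit conductances) and let H and H' be connected subgraphs of G whose edge sets have finite symmetric difference, #(E(H) △ E(H')) < ∞. Then there exists a constant c > 0, depending only on G, H, H', such that for all u, v ∈ V(H) ∩ V(H'): R_eff^H(u,v) ≤ R_eff^{H'}(u,v) + c. -/
open scoped ENNReal

open Classical in
/-- The Dirichlet energy `E_H(f) = (1/2) Σ_{x∼y in H} (f x - f y)²` of `f` for a subgraph `H`
of a graph, with unit conductances, valued in `[0,∞]`. -/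
noncomputable def subgraphEnergy {V : Type*} {G : SimpleGraph V} (H : G.Subgraph)
    (f : V → ℝ) : ℝ≥0∞ :=
  (1 / 2) * ∑' p : V × V,
    if H.Adj p.1 p.2 then ENNReal.ofReal ((f p.1 - f p.2) ^ 2) else 0

/-- The effective resistance `R_eff^H(u,v) = (inf {E_H(f) : f u = 1, f v = 0})⁻¹` between two
vertices in a subgraph `H`, valued in `[0,∞]`. -/
noncomputable def subgraphEffRes {V : Type*} {G : SimpleGraph V} (H : G.Subgraph)
    (u v : V) : ℝ≥0∞ :=
  (⨅ f : {f : V → ℝ // f u = 1 ∧ f v = 0}, subgraphEnergy H f)⁻¹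

section EnergyBounds

variable {V : Type*} {G : SimpleGraph V}

/-- The effective conductance, that is, the inverse of the effective resistance. -/
noncomputable def subgraphEffCond (H : G.Subgraph) (u v : V) : ℝ≥0∞ :=
  ⨅ f : {f : V → ℝ // f u = 1 ∧ f v = 0}, subgraphEnergy H f

theorem ENNReal.one_half_eq_ofReal : (1 / 2 : ℝ≥0∞) = ENNReal.ofReal (1 / 2) := by
  rw [ENNReal.ofReal_div_of_pos two_pos]
  simp

theorem subgraphEnergy_affine (H : G.Subgraph) (f : V → ℝ) (a b : ℝ) :
    subgraphEnergy H (fun x => a * (f x - b)) = ENNReal.ofReal (a ^ 2) * subgraphEnergy H f := by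
  classical
  unfold subgraphEnergy
  rw [mul_left_comm]
  congr 1
  rw [← ENNReal.tsum_mul_left]
  refine tsum_congr fun p => ?_
  split_ifs
  · rw [← ENNReal.ofReal_mul (sq_nonneg a)]
    congr 1
    ring
  · simp

theorem subgraphEffCond_mul_sq_le (H : G.Subgraph) (u v : V) (g : V → ℝ) :
    subgraphEffCond H u v * ENNReal.ofReal ((g u - g v) ^ 2) ≤ subgraphEnergy H g := by
  by_cases h : g u - g v = 0
  · simp [h]
  have h2 : 0 < (g u - g v) ^ 2 := by positivity
  have key : subgraphEffCond H u v ≤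
      ENNReal.ofReal ((g u - g v)⁻¹ ^ 2) * subgraphEnergy H g := by
    rw [← subgraphEnergy_affine H g _ (g v)]
    exact iInf_le (fun f : {f : V → ℝ // f u = 1 ∧ f v = 0} => subgraphEnergy H f)
      ⟨fun x => (g u - g v)⁻¹ * (g x - g v), by simp [h], by simp⟩
  calc _ ≤ ENNReal.ofReal ((g u - g v)⁻¹ ^ 2) * subgraphEnergy H g *
        ENNReal.ofReal ((g u - g v) ^ 2) := by gcongr
    _ = subgraphEnergy H g := by
      rw [mul_right_comm, ← ENNReal.ofReal_mul (by positivity), ← mul_pow, inv_mul_cancel₀ h]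
      simp

/-- Collapsing the interval `[f x, f y]` of values of `f` to a point saves the energy of the
edge `xy`. -/
theorem subgraphEnergy_collapse_add_le (H : G.Subgraph) (f : V → ℝ) {x y : V}
    (hxy : H.Adj x y) (hle : f x ≤ f y) :
    subgraphEnergy H (fun z => f z - max (f x) (min (f z) (f y))) +
      (1 / 2) * ENNReal.ofReal ((f y - f x) ^ 2) ≤ subgraphEnergy H f := by
  classical
  unfold subgraphEnergy
  rw [← mul_add, ← tsum_ite_eq (x, y) (fun _ => ENNReal.ofReal ((f y - f x) ^ 2)),
    ← ENNReal.tsum_add]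
  gcongr with p
  by_cases hp : p = (x, y)
  · subst hp
    simp only [hxy, if_true, min_eq_left hle, min_self, max_self, max_eq_right hle, sub_self]
    simp only [ne_eq, OfNat.ofNat_ne_zero, not_false_eq_true, zero_pow, ENNReal.ofReal_zero,
      zero_add]
    apply le_of_eq
    congr 1
    ring
  · simp only [hp, if_false, add_zero]
    split_ifs
    · apply ENNReal.ofReal_le_ofReal
      rw [sq_le_sq]
      grind
    · exact le_rfl

/-- Along each edge, a near-minimizer of the energy drops by at most a multiple of the
conductance. -/
theorem abs_sub_le_of_near_minimizer (H : G.Subgraph) {u v : V} {f : V → ℝ} {C δ : ℝ}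
    (hu : f u = 1) (hv : f v = 0) (hC : 0 ≤ C) (hδ : 0 ≤ δ)
    (hcond : subgraphEffCond H u v = ENNReal.ofReal C)
    (hf : subgraphEnergy H f ≤ ENNReal.ofReal (C + δ ^ 2 / 2)) {x y : V} (hxy : H.Adj x y) :
    |f x - f y| ≤ 4 * C + δ := by
  wlog hle : f x ≤ f y generalizing x y
  · rw [abs_sub_comm]
    exact this hxy.symm (le_of_not_ge hle)
  rw [abs_sub_comm, abs_of_nonneg (sub_nonneg.2 hle)]
  obtain ⟨t, ht⟩ : ∃ t, t = f y - f x := ⟨_, rfl⟩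
  have ht0 : 0 ≤ t := by linarith
  obtain ⟨γ, hγ⟩ : ∃ γ, γ = 1 - max (f x) (min 1 (f y)) - (0 - max (f x) (min 0 (f y))) :=
    ⟨_, rfl⟩
  have hγt : 1 - t ≤ γ := by
    rw [hγ, ht]
    have h1 : max (f x) (min 1 (f y)) ≤ f y := max_le hle (min_le_right _ _)
    have h2 : f x ≤ max (f x) (min 0 (f y)) := le_max_left _ _
    linarith
  have hsum := (add_le_add_left (subgraphEffCond_mul_sq_le H u v
    (fun z => f z - max (f x) (min (f z) (f y)))) _).trans
    ((subgraphEnergy_collapse_add_le H f hxy hle).trans hf)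
  simp only [hu, hv, ← hγ, ← ht, hcond] at hsum
  rw [ENNReal.one_half_eq_ofReal, ← ENNReal.ofReal_mul hC, ← ENNReal.ofReal_mul (by norm_num),
    ← ENNReal.ofReal_add (by positivity) (by positivity),
    ENNReal.ofReal_le_ofReal_iff (by positivity)] at hsum
  have hquad : t ^ 2 ≤ 4 * C * t + δ ^ 2 := by
    rcases le_total t 1 with h1 | h1
    · have : (1 - t) ^ 2 ≤ γ ^ 2 := pow_le_pow_left₀ (by linarith) hγt 2
      nlinarith [mul_le_mul_of_nonneg_left this hC, mul_nonneg hC (sq_nonneg t)]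
    · nlinarith [mul_nonneg hC (sq_nonneg γ), mul_le_mul_of_nonneg_left h1 hC]
  rw [← ht]
  by_contra! hlt
  nlinarith [mul_nonneg hC hδ]

/-- In a connected subgraph, differences of values are controlled by differences along edges. -/
theorem SimpleGraph.Subgraph.Connected.exists_abs_sub_le {H : G.Subgraph} (hH : H.Connected)
    {x y : V} (hx : x ∈ H.verts) (hy : y ∈ H.verts) :
    ∃ n : ℕ, ∀ (f : V → ℝ) (T : ℝ), (∀ a b, H.Adj a b → |f a - f b| ≤ T) →
      |f x - f y| ≤ n * T := by
  obtain ⟨w⟩ := hH.coe.preconnected ⟨x, hx⟩ ⟨y, hy⟩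
  refine ⟨w.length, fun f T hT => ?_⟩
  suffices ∀ (a b : H.verts) (w : H.coe.Walk a b), |f a - f b| ≤ w.length * T from this _ _ w
  intro a b w
  induction w with
  | nil => simp
  | @cons a b c hab w ih =>
    rw [SimpleGraph.Walk.length_cons]
    push_cast
    linarith [abs_sub_le (f a) (f b) (f c), hT a b hab]

theorem finite_adj_and_not_adj {H H' : G.Subgraph}
    (hfin : (symmDiff H.edgeSet H'.edgeSet).Finite) :
    {p : V × V | H'.Adj p.1 p.2 ∧ ¬ H.Adj p.1 p.2}.Finite := by
  refine (hfin.preimage' (f := fun p : V × V => s(p.1, p.2)) fun e _ => ?_).subset ?_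
  · induction e with | _ a b
    refine (Set.toFinite {(a, b), (b, a)}).subset ?_
    rintro ⟨c, d⟩ h
    simpa using h
  · rintro ⟨a, b⟩ ⟨h, h'⟩
    exact Or.inr ⟨h, h'⟩

theorem exists_subgraphEnergy_le {H H' : G.Subgraph} (hH : H.Connected)
    (hfin : (symmDiff H.edgeSet H'.edgeSet).Finite) :
    ∃ M : ℝ, 0 ≤ M ∧ ∀ (f : V → ℝ) (T : ℝ), (∀ a b, H.Adj a b → |f a - f b| ≤ T) →
      ∃ g : V → ℝ, (∀ x ∈ H.verts, g x = f x) ∧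
        subgraphEnergy H' g ≤ subgraphEnergy H f + ENNReal.ofReal (M * T ^ 2) := by
  classical
  obtain ⟨o, ho⟩ := hH.nonempty
  let π : V → V := fun x => if x ∈ H.verts then x else o
  have hπ : ∀ x, π x ∈ H.verts := fun x => by
    by_cases hx : x ∈ H.verts <;> simp [π, hx, ho]
  have hπ_eq : ∀ x ∈ H.verts, π x = x := fun x hx => by simp [π, hx]
  choose n hn using fun p : V × V => hH.exists_abs_sub_le (hπ p.1) (hπ p.2)
  set F := (finite_adj_and_not_adj hfin).toFinset with hF
  refine ⟨1 / 2 * ∑ p ∈ F, (n p : ℝ) ^ 2, by positivity, fun f T hT =>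
    ⟨f ∘ π, fun x hx => by simp [hπ_eq x hx], ?_⟩⟩
  have hextra : ENNReal.ofReal (1 / 2 * (∑ p ∈ F, (n p : ℝ) ^ 2) * T ^ 2) =
      1 / 2 * ∑' p, if p ∈ F then ENNReal.ofReal ((n p * T) ^ 2) else 0 := by
    rw [mul_assoc, ENNReal.ofReal_mul (by norm_num), ENNReal.one_half_eq_ofReal, Finset.sum_mul,
      ENNReal.ofReal_sum_of_nonneg (fun _ _ => by positivity),
      tsum_eq_sum (s := F) (fun p hp => by simp [hp])]
    congr 1
    refine Finset.sum_congr rfl fun p hp => ?_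
    rw [if_pos hp, mul_pow]
  unfold subgraphEnergy
  rw [hextra, ← mul_add, ← ENNReal.tsum_add]
  gcongr with p
  by_cases h' : H'.Adj p.1 p.2
  · by_cases h : H.Adj p.1 p.2
    · simp only [h', h, if_true, Function.comp_apply, hπ_eq _ h.fst_mem, hπ_eq _ h.snd_mem]
      exact le_self_add
    · have hp : p ∈ F := by simp [hF, h, h']
      simp only [h', h, hp, if_true, if_false, zero_add, Function.comp_apply]
      apply ENNReal.ofReal_le_ofReal
      rw [← sq_abs]
      exact pow_le_pow_left₀ (abs_nonneg _) (hn p f T hT) 2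
  · simp [h']

theorem exists_subgraphEffCond_le {H H' : G.Subgraph} (hH : H.Connected)
    (hfin : (symmDiff H.edgeSet H'.edgeSet).Finite) :
    ∃ m : ℝ, 0 ≤ m ∧ ∀ u ∈ H.verts, ∀ v ∈ H.verts, ∀ C : ℝ, 0 ≤ C →
      subgraphEffCond H u v = ENNReal.ofReal C →
      subgraphEffCond H' u v ≤ ENNReal.ofReal (C + m * C ^ 2) := by
  obtain ⟨M, hM, hext⟩ := exists_subgraphEnergy_le hH hfin
  refine ⟨16 * M, by positivity, fun u hu v hv C hC hcond => ?_⟩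
  have hbound : ∀ δ : ℝ, 0 < δ → subgraphEffCond H' u v ≤
      ENNReal.ofReal (C + δ ^ 2 / 2 + M * (4 * C + δ) ^ 2) := by
    intro δ hδ
    have hlt : subgraphEffCond H u v < ENNReal.ofReal (C + δ ^ 2 / 2) := by
      rw [hcond, ENNReal.ofReal_lt_ofReal_iff (by positivity)]
      linarith [pow_pos hδ 2]
    obtain ⟨⟨f, hfu, hfv⟩, hf⟩ := iInf_lt_iff.1 hlt
    obtain ⟨g, hg, hE⟩ := hext f (4 * C + δ) fun a b hab =>
      abs_sub_le_of_near_minimizer H hfu hfv hC hδ.le hcond hf.le hab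
    calc subgraphEffCond H' u v ≤ subgraphEnergy H' g :=
          iInf_le (fun f : {f : V → ℝ // f u = 1 ∧ f v = 0} => subgraphEnergy H' f)
            ⟨g, (hg u hu).trans hfu, (hg v hv).trans hfv⟩
      _ ≤ _ := hE
      _ ≤ _ := by
        rw [ENNReal.ofReal_add (by positivity) (by positivity)]
        gcongr
  have hcont : Continuous fun δ : ℝ =>
      ENNReal.ofReal (C + δ ^ 2 / 2 + M * (4 * C + δ) ^ 2) :=
    ENNReal.continuous_ofReal.comp (by fun_prop)
  have hlim := (hcont.tendsto 0).mono_left (nhdsWithin_le_nhds (s := Set.Ioi 0))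
  have hzero : C + 16 * M * C ^ 2 = C + 0 ^ 2 / 2 + M * (4 * C + 0) ^ 2 := by ring
  rw [hzero]
  exact ge_of_tendsto hlim (Filter.eventually_of_mem self_mem_nhdsWithin hbound)

end EnergyBounds

/-- Effective resistance is stable under finite modifications: if `H` and `H'` are connected
subgraphs of a locally finite graph `G` with `#(E(H) △ E(H')) < ∞`, then there is a constant
`c > 0` (depending only on `G`, `H`, `H'`) with
`R_eff^H(u,v) ≤ R_eff^{H'}(u,v) + c` for all `u, v ∈ V(H) ∩ V(H')`. -/
theorem effRes_stable_of_finite_symmDiff {V : Type*} (G : SimpleGraph V) [G.LocallyFinite]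
    (H H' : G.Subgraph) (hH : H.Connected) (hH' : H'.Connected)
    (hfin : (symmDiff H.edgeSet H'.edgeSet).Finite) :
    ∃ c : ℝ, 0 < c ∧ ∀ u v : V, u ∈ H.verts ∩ H'.verts → v ∈ H.verts ∩ H'.verts →
      subgraphEffRes H u v ≤ subgraphEffRes H' u v + ENNReal.ofReal c := by
  obtain ⟨m, hm, hle⟩ := exists_subgraphEffCond_le hH hfin
  refine ⟨m + 1, by positivity, fun u v hu hv => ?_⟩
  change (subgraphEffCond H u v)⁻¹ ≤ (subgraphEffCond H' u v)⁻¹ + _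
  rcases eq_or_ne (subgraphEffCond H u v) ⊤ with htop | htop
  · simp [htop]
  obtain ⟨C, hC⟩ : ∃ C, C = (subgraphEffCond H u v).toReal := ⟨_, rfl⟩
  have hC0 : 0 ≤ C := hC ▸ ENNReal.toReal_nonneg
  have hcond : subgraphEffCond H u v = ENNReal.ofReal C := by rw [hC, ENNReal.ofReal_toReal htop]
  have hcond' := hle u hu.1 v hv.1 C hC0 hcond
  rcases hC0.eq_or_lt with rfl | hpos
  · have hzero : subgraphEffCond H' u v = 0 := by simpa using hcond'
    simp [hzero]
  calc (subgraphEffCond H u v)⁻¹ = ENNReal.ofReal C⁻¹ := by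
        rw [hcond, ENNReal.ofReal_inv_of_pos hpos]
    _ ≤ ENNReal.ofReal ((C + m * C ^ 2)⁻¹ + (m + 1)) := by
        apply ENNReal.ofReal_le_ofReal
        have hden : 0 < C + m * C ^ 2 := by positivity
        rw [← sub_nonneg]
        have : (C + m * C ^ 2)⁻¹ + (m + 1) - C⁻¹ =
            (C + m * C ^ 2 + m ^ 2 * C ^ 2) / (C + m * C ^ 2) := by
          field_simp
          ring
        rw [this]
        positivity
    _ = (ENNReal.ofReal (C + m * C ^ 2))⁻¹ + ENNReal.ofReal (m + 1) := by
        rw [ENNReal.ofReal_add (by positivity) (by positivity),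
          ENNReal.ofReal_inv_of_pos (by positivity)]
    _ ≤ _ := by gcongr
end

section
/- (Kac's formula) Let (Ω, 𝒜, P) be a probability space and T : Ω → Ω a measurable map that preserves P and is ergodic. Let E ∈ 𝒜 with P(E) > 0 and let τ(ω) := inf{n ∈ ℕ, n ≥ 1 : T^n(ω) ∈ E}. Then E[τ | E] = P(E)^{-1}; equivalently, ∫_E τ dP = 1. -/
open MeasureTheory ProbabilityTheory

/-- The first return time to `E`: `τ(ω) = inf {n ≥ 1 : T^[n] ω ∈ E}` (with value `0` by
convention if the orbit never returns to `E`). -/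
noncomputable def returnTime {Ω : Type*} (T : Ω → Ω) (E : Set Ω) (ω : Ω) : ℕ :=
  sInf {n : ℕ | 1 ≤ n ∧ T^[n] ω ∈ E}

/-- The points whose orbit avoids `E` at all times `k < n`. -/
def avoidingSet {Ω : Type*} (T : Ω → Ω) (E : Set Ω) (n : ℕ) : Set Ω :=
  {ω | ∀ k < n, T^[k] ω ∉ E}

theorem avoidingSet_succ {Ω : Type*} (T : Ω → Ω) (E : Set Ω) (n : ℕ) :
    avoidingSet T E (n + 1) = T ⁻¹' avoidingSet T E n \ E := by
  ext ω
  simp only [avoidingSet, Set.mem_sdiff, Set.mem_preimage, Set.mem_ofPred_eq,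
    Nat.forall_lt_succ_left, Function.iterate_succ_apply, Function.iterate_zero, id_eq]
  exact and_comm

theorem antitone_avoidingSet {Ω : Type*} (T : Ω → Ω) (E : Set Ω) :
    Antitone (avoidingSet T E) :=
  fun _ _ hmn _ hω k hk => hω k (hk.trans_le hmn)

theorem measurableSet_avoidingSet {Ω : Type*} [MeasurableSpace Ω] {T : Ω → Ω}
    (hT : Measurable T) {E : Set Ω} (hE : MeasurableSet E) (n : ℕ) :
    MeasurableSet (avoidingSet T E n) := by
  induction n with
  | zero => simp [avoidingSet]
  | succ n ih =>
    rw [avoidingSet_succ]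
    exact (hT ih).diff hE

/-- Under an ergodic map, almost every orbit meets a given set of positive measure. -/
theorem measure_iInter_avoidingSet {Ω : Type*} [MeasurableSpace Ω] {μ : Measure Ω}
    [IsFiniteMeasure μ] {T : Ω → Ω} (hT : Ergodic T μ) {E : Set Ω} (hE : MeasurableSet E)
    (hEpos : μ E ≠ 0) : μ (⋂ n, avoidingSet T E n) = 0 := by
  have hsub : (⋂ n, avoidingSet T E n) ⊆ T ⁻¹' ⋂ n, avoidingSet T E n := by
    intro ω hω
    rw [Set.preimage_iInter]
    refine Set.mem_iInter.2 fun n => ?_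
    have h := Set.mem_iInter.1 hω (n + 1)
    rw [avoidingSet_succ] at h
    exact h.1
  have hdisj : E ⊆ (⋂ n, avoidingSet T E n)ᶜ :=
    fun ω hω h => Set.mem_iInter.1 h 1 0 one_pos hω
  rcases hT.ae_empty_or_univ_of_ae_le_preimage
    (MeasurableSet.iInter (measurableSet_avoidingSet hT.measurable hE)).nullMeasurableSet
    hsub.eventuallyLE with h | h
  · exact ae_eq_empty.1 h
  · exact absurd (measure_mono_null hdisj (ae_eq_univ.1 h)) hEpos

theorem sum_measure_inter_preimage_avoidingSet {Ω : Type*} [MeasurableSpace Ω] {μ : Measure Ω}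
    {T : Ω → Ω} (hT : MeasurePreserving T μ μ) {E : Set Ω} (hE : MeasurableSet E) (N : ℕ) :
    ∑ n ∈ Finset.range N, μ (T ⁻¹' avoidingSet T E n ∩ E) + μ (avoidingSet T E N)
      = μ Set.univ := by
  induction N with
  | zero => simp [avoidingSet]
  | succ N ih =>
    rw [Finset.sum_range_succ, avoidingSet_succ, add_assoc, measure_inter_add_sdiff _ hE,
      hT.measure_preimage (measurableSet_avoidingSet hT.measurable hE N).nullMeasurableSet, ih]

theorem lt_returnTime_iff {Ω : Type*} {T : Ω → Ω} {E : Set Ω} {ω : Ω}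
    (hω : T ω ∉ ⋂ n, avoidingSet T E n) (n : ℕ) :
    n < returnTime T E ω ↔ ω ∈ T ⁻¹' avoidingSet T E n := by
  have hne : {n : ℕ | 1 ≤ n ∧ T^[n] ω ∈ E}.Nonempty := by
    simp only [Set.mem_iInter, not_forall, avoidingSet, Set.mem_ofPred_eq, not_not] at hω
    obtain ⟨_, k, _, hk⟩ := hω
    exact ⟨k + 1, by omega, hk⟩
  constructor
  · intro h k hk hmem
    have : returnTime T E ω ≤ k + 1 := Nat.sInf_le ⟨by omega, hmem⟩
    omega
  · intro h
    obtain ⟨h1, h2⟩ : 1 ≤ returnTime T E ω ∧ T^[returnTime T E ω] ω ∈ E := Nat.sInf_mem hne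
    by_contra! hle
    refine h (returnTime T E ω - 1) (by omega) ?_
    rwa [← Function.iterate_succ_apply, Nat.succ_eq_add_one, Nat.sub_add_cancel h1]

theorem returnTime_eq_tsum_indicator {Ω : Type*} {T : Ω → Ω} {E : Set Ω} {ω : Ω}
    (hω : T ω ∉ ⋂ n, avoidingSet T E n) :
    (returnTime T E ω : ENNReal)
      = ∑' n, (T ⁻¹' avoidingSet T E n).indicator (fun _ => 1) ω := by
  rw [tsum_eq_sum (s := Finset.range (returnTime T E ω))]
  · rw [Finset.sum_congr rfl fun n hn => Set.indicator_of_mem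
      ((lt_returnTime_iff hω n).1 (Finset.mem_range.1 hn)) _]
    simp
  · intro n hn
    exact Set.indicator_of_notMem
      (fun h => hn (Finset.mem_range.2 ((lt_returnTime_iff hω n).2 h))) _

/-- Kac's formula: if `T` is an ergodic measure-preserving map of a probability space
`(Ω, μ)` and `μ E > 0`, then `∫_E τ dμ = 1`; equivalently `E[τ | E] = μ(E)⁻¹`. -/
theorem kac_formula {Ω : Type*} [MeasurableSpace Ω]
    (μ : Measure Ω) [IsProbabilityMeasure μ] (T : Ω → Ω) (hT : Ergodic T μ)
    (E : Set Ω) (hE : MeasurableSet E) (hEpos : 0 < μ E) :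
    ∫⁻ ω in E, (returnTime T E ω : ENNReal) ∂μ = 1 := by
  have hmeas := measurableSet_avoidingSet hT.measurable hE
  have hnull := measure_iInter_avoidingSet hT hE hEpos.ne'
  have hae : ∀ᵐ ω ∂μ, T ω ∉ ⋂ n, avoidingSet T E n :=
    hT.quasiMeasurePreserving.ae (measure_eq_zero_iff_ae_notMem.1 hnull)
  have hsum : ∫⁻ ω in E, (returnTime T E ω : ENNReal) ∂μ
      = ∑' n, μ (T ⁻¹' avoidingSet T E n ∩ E) := by
    rw [lintegral_congr_ae (ae_restrict_of_ae
      (hae.mono fun ω hω => returnTime_eq_tsum_indicator hω)),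
      lintegral_tsum fun n => (measurable_const.indicator (hT.measurable (hmeas n))).aemeasurable]
    refine tsum_congr fun n => ?_
    rw [lintegral_indicator_const (hT.measurable (hmeas n)), one_mul,
      Measure.restrict_apply (hT.measurable (hmeas n))]
  have hlim : Filter.Tendsto (fun N => μ (avoidingSet T E N)) Filter.atTop (nhds 0) := by
    rw [← hnull]
    exact tendsto_measure_iInter_atTop (fun n => (hmeas n).nullMeasurableSet)
      (antitone_avoidingSet T E) ⟨0, measure_ne_top _ _⟩
  have htend := (ENNReal.tendsto_nat_tsum
    fun n => μ (T ⁻¹' avoidingSet T E n ∩ E)).add hlim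
  simp only [sum_measure_inter_preimage_avoidingSet hT.toMeasurePreserving hE, measure_univ,
    add_zero] at htend
  rw [hsum]
  exact tendsto_nhds_unique htend tendsto_const_nhds
end

section
/- Let G be a finite connected graph, let B be a subgraph of G, and let K be a subgraph of B with the property that every edge of B whose two endpoints lie in the same connected component of K is an edge of K (i.e., K equals its own induced-component graph within B). Let F₁ and F₂ be spanning forests of K (subgraphs with V(F_i) = V(K)) whose restriction to each connected component of K is a spanning tree of that component. Then the number of spanning trees T of G with E(T) ∩ E(B) = E(F₁) equals the number of spanning trees T of G with E(T) ∩ E(B) = E(F₂). -/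
namespace SimpleGraph

variable {V : Type*} {G H S F₁ F₂ B : SimpleGraph V}

/-- If the endpoints of every edge of `G` are joined in `H`, then so are any two vertices joined
in `G`. -/
lemma Reachable.of_forall_adj (h : ∀ x y, G.Adj x y → H.Reachable x y) {u v : V}
    (huv : G.Reachable u v) : H.Reachable u v := by
  obtain ⟨p⟩ := huv
  induction p with
  | nil => rfl
  | cons hadj _ ih => exact (h _ _ hadj).trans ih

lemma Connected.sup_of_forall_adj_reachable (hF : ∀ x y, F₁.Adj x y → F₂.Reachable x y)
    (h : (S ⊔ F₁).Connected) : (S ⊔ F₂).Connected := by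
  have := h.nonempty
  refine ⟨fun u v ↦ (h.preconnected u v).of_forall_adj fun x y hxy ↦ ?_⟩
  rcases hxy with hxy | hxy
  · exact Adj.reachable (Or.inl hxy)
  · exact (hF x y hxy).mono le_sup_right

lemma IsTree.eq_of_connected_of_le (hG : G.IsTree) (hH : H.Connected) (hle : H ≤ G) : H = G :=
  le_antisymm hle ((isTree_iff_minimal_connected.mp hG).le_of_le hH hle)

/-- Exchanging a part `F₁` of a tree for an acyclic graph with the same connected components
yields a tree. -/
lemma IsTree.sup_of_reachable_iff (hT : (S ⊔ F₁).IsTree) (hS : Disjoint S F₁)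
    (hF₂ : F₂.IsAcyclic) (hF : ∀ x y, F₁.Reachable x y ↔ F₂.Reachable x y) :
    (S ⊔ F₂).IsTree := by
  obtain ⟨T, hF₂T, hTle, hTtree⟩ := (hT.connected.sup_of_forall_adj_reachable
    fun x y h ↦ (hF x y).1 h.reachable).exists_isTree_le_of_le_of_isAcyclic le_sup_right hF₂
  have hTeq : T ⊓ S ⊔ F₂ = T := by
    rw [sup_comm, sup_inf_left, sup_eq_right.2 hF₂T, inf_eq_left, sup_comm]
    exact hTle
  have hconn : (T ⊓ S ⊔ F₁).Connected := by
    refine Connected.sup_of_forall_adj_reachable (fun x y h ↦ (hF x y).2 h.reachable) ?_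
    rw [hTeq]
    exact hTtree.connected
  have heq := hT.eq_of_connected_of_le hconn (sup_le_sup_right inf_le_right F₁)
  have hST : S ≤ T :=
    (hS.left_le_of_le_sup_right (le_sup_left.trans heq.ge)).trans inf_le_left
  rwa [le_antisymm (sup_le hST hF₂T) hTle]

lemma edgeSet_inter_eq_edgeSet_iff : G.edgeSet ∩ B.edgeSet = H.edgeSet ↔ G ⊓ B = H := by
  rw [← edgeSet_inf, edgeSet_inj]

lemma ncard_isTree_inter_le [Finite V] (hF₁B : F₁ ≤ B) (hF₂B : F₂ ≤ B) (hBG : B ≤ G)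
    (hF₂ : F₂.IsAcyclic) (hF : ∀ x y, F₁.Reachable x y ↔ F₂.Reachable x y) :
    {T : SimpleGraph V | T ≤ G ∧ T.IsTree ∧ T.edgeSet ∩ B.edgeSet = F₁.edgeSet}.ncard ≤
    {T : SimpleGraph V | T ≤ G ∧ T.IsTree ∧ T.edgeSet ∩ B.edgeSet = F₂.edgeSet}.ncard := by
  simp only [edgeSet_inter_eq_edgeSet_iff]
  have hdecomp {T : SimpleGraph V} (hT : T ⊓ B = F₁) : T \ B ⊔ F₁ = T := by
    rw [← hT, sup_comm, sup_inf_sdiff]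
  refine Set.ncard_le_ncard_of_injOn (fun T ↦ T \ B ⊔ F₂) ?_ ?_ (Set.toFinite _)
  · rintro T ⟨hTG, hTtree, hTB⟩
    refine ⟨sup_le (sdiff_le.trans hTG) (hF₂B.trans hBG), ?_, ?_⟩
    · refine IsTree.sup_of_reachable_iff ?_ (disjoint_sdiff_self_left.mono_right hF₁B) hF₂ hF
      rwa [hdecomp hTB]
    · rw [inf_sup_right, inf_eq_left.2 hF₂B, disjoint_sdiff_self_left.eq_bot, bot_sup_eq]
  · rintro T ⟨-, -, hT⟩ T' ⟨-, -, hT'⟩ h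
    have h' := congrArg (· \ B) h
    simp only [sup_sdiff, sdiff_idem, sdiff_eq_bot_iff.2 hF₂B, sup_bot_eq] at h'
    rw [← hdecomp hT, h', hdecomp hT']

end SimpleGraph

/-- Let `G` be a finite connected graph, `B ≤ G` a subgraph, and `K ≤ B` a subgraph equal
to its own induced-component graph within `B` (every edge of `B` joining two vertices in
the same component of `K` is an edge of `K`).  If `F₁` and `F₂` are spanning forests of `K`
whose restriction to each connected component of `K` is a spanning tree of that component
(i.e. `Fᵢ ≤ K`, `Fᵢ` is acyclic, and `Fᵢ` has the same connected components as `K`), then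
the number of spanning trees `T` of `G` with `E(T) ∩ E(B) = E(F₁)` equals the number of
spanning trees `T` of `G` with `E(T) ∩ E(B) = E(F₂)`. -/
theorem card_spanningTrees_inter_eq {V : Type*} [Fintype V]
    (G B K F₁ F₂ : SimpleGraph V)
    (hG : G.Connected) (hB : B ≤ G) (hK : K ≤ B)
    (hKind : ∀ x y : V, B.Adj x y → K.Reachable x y → K.Adj x y)
    (hF₁ : F₁ ≤ K) (hF₁ac : F₁.IsAcyclic)
    (hF₁comp : ∀ x y : V, K.Reachable x y ↔ F₁.Reachable x y)
    (hF₂ : F₂ ≤ K) (hF₂ac : F₂.IsAcyclic)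
    (hF₂comp : ∀ x y : V, K.Reachable x y ↔ F₂.Reachable x y) :
    {T : SimpleGraph V | T ≤ G ∧ T.IsTree ∧ T.edgeSet ∩ B.edgeSet = F₁.edgeSet}.ncard =
    {T : SimpleGraph V | T ≤ G ∧ T.IsTree ∧ T.edgeSet ∩ B.edgeSet = F₂.edgeSet}.ncard := by
  have hF : ∀ x y, F₁.Reachable x y ↔ F₂.Reachable x y := fun x y ↦
    (hF₁comp x y).symm.trans (hF₂comp x y)
  exact le_antisymm
    (SimpleGraph.ncard_isTree_inter_le (hF₁.trans hK) (hF₂.trans hK) hB hF₂ac hF)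
    (SimpleGraph.ncard_isTree_inter_le (hF₂.trans hK) (hF₁.trans hK) hB hF₁ac
      fun x y ↦ (hF x y).symm)
end
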